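/- arXiv:2006.09064 — 2 statements merged into one kernel-verified Lean document; each statement's English description precedes it below -/
import Mathlib

section
/- Let S be a nonempty finite set, let k ≥ 2, and let p be a probability distribution on S^k satisfying local translation invariance (LTI): the marginal of p on the first k−1 coordinates equals the marginal of p on the last k−1 coordinates. Then there exists a probability measure μ on S^ℤ (with the product σ-algebra) that is invariant under the shift map T((x_n)_{n∈ℤ}) = (x_{n+1})_{n∈ℤ}, i.e., the pushforward of μ under T equals μ, and such that the pushforward of μ under the window map x ↦ (x_1, x_2, …, x_k) equals p (so, by shift invariance, the marginal of μ on any k consecutive sites equals p). -/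
open MeasureTheory

open ProbabilityTheory Filter Topology

/-- Gluing: a law on words of length `r + 1` whose two marginals on words of length `r` agree
is both marginals of a law on words of length `r + 2`. -/
lemma exists_extension_of_map_castSucc_eq_map_succ {S : Type*} [Finite S] [Nonempty S]
    [MeasurableSpace S] [DiscreteMeasurableSpace S] {r : ℕ}
    (q : Measure (Fin (r + 1) → S)) [IsProbabilityMeasure q]
    (hq : q.map (fun x (i : Fin r) => x i.castSucc) = q.map (fun x (i : Fin r) => x i.succ)) :
    ∃ q' : Measure (Fin (r + 2) → S), IsProbabilityMeasure q' ∧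
      q'.map (fun x (i : Fin (r + 1)) => x i.castSucc) = q ∧
      q'.map (fun x (i : Fin (r + 1)) => x i.succ) = q := by
  set ρ : Measure ((Fin r → S) × S) := q.map (fun x => (fun i => x i.castSucc, x (Fin.last r)))
    with hρ
  have : IsProbabilityMeasure ρ := Measure.isProbabilityMeasure_map (by fun_prop)
  have hfst : ρ.fst = q.map (fun x (i : Fin r) => x i.succ) := by
    rw [← hq, Measure.fst, hρ, Measure.map_map (by fun_prop) (by fun_prop)]
    rfl
  set κ : Kernel (Fin (r + 1) → S) S :=
    ρ.condKernel.comap (fun x i => x i.succ) (by fun_prop) with hκ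
  have hsnoc (n : ℕ) :
      Measurable (fun y : (Fin n → S) × S => (Fin.snoc y.1 y.2 : Fin (n + 1) → S)) :=
    .of_discrete
  have hprod : (q ⊗ₘ κ).map (Prod.map (fun x (i : Fin r) => x i.succ) id) = ρ := by
    rw [← ρ.disintegrate ρ.condKernel, hfst]
    ext s hs
    rw [Measure.map_apply (by fun_prop) hs, Measure.compProd_apply (by measurability),
      Measure.compProd_apply hs, lintegral_map (Kernel.measurable_kernel_prodMk_left hs)
        (by fun_prop)]
    rfl
  refine ⟨(q ⊗ₘ κ).map (fun y => Fin.snoc y.1 y.2),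
    Measure.isProbabilityMeasure_map (hsnoc _).aemeasurable, ?_, ?_⟩
  · rw [Measure.map_map (by fun_prop) (hsnoc _)]
    conv_rhs => rw [← Measure.fst_compProd q κ]
    rw [Measure.fst]
    congr 1
    ext y i
    simp
  · have hcomp : (fun (x : Fin (r + 2) → S) (i : Fin (r + 1)) => x i.succ) ∘
        (fun y : (Fin (r + 1) → S) × S => Fin.snoc y.1 y.2) =
        (fun y : (Fin r → S) × S => (Fin.snoc y.1 y.2 : Fin (r + 1) → S)) ∘
          Prod.map (fun x (i : Fin r) => x i.succ) id := by
      ext y i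
      refine Fin.lastCases ?_ (fun i => ?_) i
      · simp [Fin.succ_last]
      · simp only [Function.comp_apply, Fin.succ_castSucc, Fin.snoc_castSucc, Prod.map_fst]
    rw [Measure.map_map (by fun_prop) (hsnoc _), hcomp, ← Measure.map_map (hsnoc _) (by fun_prop),
      hprod, hρ, Measure.map_map (hsnoc _) (by fun_prop)]
    convert Measure.map_id
    ext x i
    refine Fin.lastCases ?_ (fun i => ?_) i <;> simp

/-- A locally translation invariant law of words of length `m + 1` is the law of all windows of
a locally translation invariant law of words of length `m + N + 1`. -/
lemma exists_block_measure {S : Type*} [Finite S] [Nonempty S]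
    [MeasurableSpace S] [DiscreteMeasurableSpace S] {m : ℕ}
    (P : Measure (Fin (m + 1) → S)) [IsProbabilityMeasure P]
    (hP : P.map (fun x (i : Fin m) => x i.castSucc) = P.map (fun x (i : Fin m) => x i.succ))
    (N : ℕ) :
    ∃ q : Measure (Fin (m + N + 1) → S), IsProbabilityMeasure q ∧
      q.map (fun x (i : Fin (m + N)) => x i.castSucc) =
        q.map (fun x (i : Fin (m + N)) => x i.succ) ∧
      ∀ (j : ℕ) (hj : j ≤ N),
        q.map (fun x (i : Fin (m + 1)) => x ⟨j + i, by omega⟩) = P := by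
  induction N with
  | zero =>
    refine ⟨P, inferInstance, hP, fun j hj => ?_⟩
    obtain rfl : j = 0 := by omega
    convert Measure.map_id
    simp
  | succ N ih =>
    obtain ⟨q, _, hq, hw⟩ := ih
    obtain ⟨q', hq', hleft, hright⟩ := exists_extension_of_map_castSucc_eq_map_succ q hq
    refine ⟨q', hq', hleft.trans hright.symm, fun j hj => ?_⟩
    rcases Nat.lt_or_ge N j with h | h
    · rw [← hw N le_rfl, ← hright, Measure.map_map (by fun_prop) (by fun_prop)]
      congr 1
      ext x i
      simp only [Function.comp_apply, Fin.succ_mk]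
      congr 2
      omega
    · rw [← hw j h, ← hleft, Measure.map_map (by fun_prop) (by fun_prop)]
      rfl

/-- A locally translation invariant law of words is the window marginal of a law on
bi-infinite words which is shift-invariant on the sites of absolute value less than `N`. -/
lemma exists_measure_shift_invariant_on_block {S : Type*} [Finite S] [Nonempty S]
    [MeasurableSpace S] [DiscreteMeasurableSpace S] {m : ℕ}
    (P : Measure (Fin (m + 1) → S)) [IsProbabilityMeasure P]
    (hP : P.map (fun x (i : Fin m) => x i.castSucc) = P.map (fun x (i : Fin m) => x i.succ))
    (N : ℕ) :
    ∃ ν : ProbabilityMeasure (ℤ → S),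
      (∀ I : Finset ℤ, (∀ z ∈ I, z.natAbs ≤ N) →
        (ν : Measure (ℤ → S)).map (fun x (z : I) => x ((z : ℤ) + 1)) =
          (ν : Measure (ℤ → S)).map I.restrict) ∧
      (ν : Measure (ℤ → S)).map (fun x (i : Fin (m + 1)) => x ((i.1 : ℤ) + 1)) = P := by
  obtain ⟨q, _, hq, hw⟩ := exists_block_measure P hP (2 * N + 1)
  set E : (Fin (m + (2 * N + 1) + 1) → S) → ℤ → S :=
    fun x z => x ⟨min (z + N).toNat (m + (2 * N + 1)), by omega⟩ with hE
  have hEm : Measurable E := by fun_prop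
  refine ⟨⟨q.map E, Measure.isProbabilityMeasure_map hEm.aemeasurable⟩, fun I hI => ?_, ?_⟩
  · set g : (Fin (m + (2 * N + 1)) → S) → I → S :=
      fun y z => y ⟨min ((z : ℤ) + N).toNat (m + 2 * N), by omega⟩ with hg
    have hgm : Measurable g := by fun_prop
    have hs : (fun (x : ℤ → S) (z : I) => x ((z : ℤ) + 1)) ∘ E = g ∘ fun x i => x i.succ := by
      ext x z
      have := hI z z.2
      simp only [hE, hg, Function.comp_apply, Fin.succ_mk]
      congr 2
      omega
    have hc : I.restrict ∘ E = g ∘ fun x i => x i.castSucc := by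
      ext x z
      have := hI z z.2
      simp only [hE, hg, Function.comp_apply, Fin.castSucc_mk, Finset.restrict]
      congr 2
      omega
    rw [ProbabilityMeasure.coe_mk, Measure.map_map (by fun_prop) hEm, hs,
      Measure.map_map (by fun_prop) hEm, hc, ← Measure.map_map hgm (by fun_prop), ← hq,
      Measure.map_map hgm (by fun_prop)]
  · rw [ProbabilityMeasure.coe_mk, Measure.map_map (by fun_prop) hEm, ← hw (N + 1) (by omega)]
    congr 1
    ext x i
    simp only [hE, Function.comp_apply]
    congr 2
    omega

/-- Local translation invariance of a law of words implies the existence of a shift-invariant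
extension to bi-infinite words. -/
lemma exists_shift_invariant_measure {S : Type*} [Finite S] [Nonempty S]
    [MeasurableSpace S] [DiscreteMeasurableSpace S] {m : ℕ}
    (P : Measure (Fin (m + 1) → S)) [IsProbabilityMeasure P]
    (hP : P.map (fun x (i : Fin m) => x i.castSucc) = P.map (fun x (i : Fin m) => x i.succ)) :
    ∃ μ : Measure (ℤ → S), IsProbabilityMeasure μ ∧
      μ.map (fun x n => x (n + 1)) = μ ∧
      μ.map (fun x (i : Fin (m + 1)) => x ((i.1 : ℤ) + 1)) = P := by
  let : TopologicalSpace S := ⊥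
  have : DiscreteTopology S := ⟨rfl⟩
  choose ν hinv hwin using exists_measure_shift_invariant_on_block P hP
  obtain ⟨μ, hμ⟩ : ∃ μ, Tendsto ν (hyperfilter ℕ) (𝓝 μ) := by
    obtain ⟨μ, -, hμ⟩ := isCompact_univ.ultrafilter_le_nhds
      (Ultrafilter.map ν (hyperfilter ℕ)) (by simp)
    exact ⟨μ, hμ⟩
  have hlim {A : Set (ℤ → S)} (hA : IsClopen A) :
      Tendsto (fun n => (ν n : Measure (ℤ → S)) A) (hyperfilter ℕ)
        (𝓝 ((μ : Measure (ℤ → S)) A)) :=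
    ProbabilityMeasure.tendsto_measure_of_null_frontier_of_tendsto' hμ (by simp [hA.frontier_eq])
  have hT : Measurable (fun (x : ℤ → S) (n : ℤ) => x (n + 1)) := by fun_prop
  refine ⟨μ, inferInstance, ?_, ?_⟩
  · have := Measure.isProbabilityMeasure_map (μ := (μ : Measure (ℤ → S))) hT.aemeasurable
    refine IsProjectiveLimit.unique (P := fun I => (μ : Measure (ℤ → S)).map I.restrict)
      (fun I => ?_) (fun I => rfl)
    rw [Measure.map_map (by fun_prop) hT]
    ext A hA
    rw [Measure.map_apply (by fun_prop) hA, Measure.map_apply (by fun_prop) hA]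
    have hAc : IsClopen A := isClopen_discrete A
    refine tendsto_nhds_unique (hlim (hAc.preimage (by fun_prop)))
      ((hlim (hAc.preimage (by fun_prop))).congr' ?_)
    refine Nat.hyperfilter_le_atTop ?_
    filter_upwards [eventually_ge_atTop (I.sup Int.natAbs)] with N hN
    have h := hinv N I fun z hz => (Finset.le_sup (f := Int.natAbs) hz).trans hN
    rw [← Measure.map_apply (by fun_prop) hA, ← h, Measure.map_apply (by fun_prop) hA]
    rfl
  · ext A hA
    rw [Measure.map_apply (by fun_prop) hA]
    refine tendsto_nhds_unique (hlim ((isClopen_discrete A).preimage (by fun_prop)))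
      (tendsto_const_nhds.congr fun N => ?_)
    rw [← Measure.map_apply (by fun_prop) hA, hwin N]

/-- Any locally translation invariant distribution `p` on a window of `k ≥ 2` consecutive
sites of the infinite chain (marginal on the first `k-1` coordinates equals marginal on
the last `k-1` coordinates) is the window marginal of a shift-invariant probability
measure on `S^ℤ`. -/
theorem stmt7 {S : Type*} [Fintype S] [Nonempty S] [DecidableEq S]
    [MeasurableSpace S] [DiscreteMeasurableSpace S]
    {k : ℕ} (hk : 2 ≤ k)
    (p : (Fin k → S) → ℝ)
    (hpos : ∀ f, 0 ≤ p f) (hsum : ∑ f, p f = 1)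
    (hLTI : ∀ g : Fin (k - 1) → S,
      (∑ f ∈ Finset.univ.filter (fun f : Fin k → S =>
          ∀ i : Fin (k - 1), f ⟨i.1, by have := i.2; omega⟩ = g i), p f) =
      (∑ f ∈ Finset.univ.filter (fun f : Fin k → S =>
          ∀ i : Fin (k - 1), f ⟨i.1 + 1, by have := i.2; omega⟩ = g i), p f)) :
    ∃ μ : Measure (ℤ → S), IsProbabilityMeasure μ ∧
      μ.map (fun x n => x (n + 1)) = μ ∧
      ∀ f : Fin k → S,
        μ.map (fun x (i : Fin k) => x ((i.1 : ℤ) + 1)) {f} = ENNReal.ofReal (p f) := by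
  obtain ⟨m, rfl⟩ : ∃ m, k = m + 1 := ⟨k - 1, by omega⟩
  have hone : ∑ f, ENNReal.ofReal (p f) = 1 := by
    rw [← ENNReal.ofReal_sum_of_nonneg fun f _ => hpos f, hsum, ENNReal.ofReal_one]
  set P : Measure (Fin (m + 1) → S) := (PMF.ofFintype _ hone).toMeasure with hP
  have hmap (φ : (Fin (m + 1) → S) → Fin m → S) (g : Fin m → S) :
      P.map φ {g} = ENNReal.ofReal (∑ f with φ f = g, p f) := by
    rw [Measure.map_apply .of_discrete (.singleton g), hP, PMF.toMeasure_apply_fintype,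
      ENNReal.ofReal_sum_of_nonneg fun f _ => hpos f, Finset.sum_filter]
    refine Finset.sum_congr rfl fun f _ => ?_
    by_cases h : φ f = g <;> simp [h]
  obtain ⟨μ, hμ, hinv, hwin⟩ := exists_shift_invariant_measure P <| by
    refine Measure.ext_of_singleton fun g => ?_
    rw [hmap, hmap]
    convert congrArg ENNReal.ofReal (hLTI g) using 4 <;> exact funext_iff
  refine ⟨μ, hμ, hinv, fun f => ?_⟩
  rw [hwin, hP, PMF.toMeasure_apply_singleton _ _ (.singleton f), PMF.ofFintype_apply]
end

section
/- Let S be a nonempty finite set, let l ≥ 2, and let p be a probability distribution on the configurations {1,2}×{1,…,l} → S of a 2×l plaquette such that: (a) p is invariant under swapping the two columns x = 1 and x = 2, and (b) p is locally translation invariant along the second axis, i.e., the marginal of p on the sites {1,2}×{1,…,l−1} equals its marginal on the sites {1,2}×{2,…,l}. Then there exists a probability measure μ on S^(ℤ×ℤ) (with the product σ-algebra) that is invariant under all translations of ℤ² and invariant under the reflection (x,y) ↦ (−x,y), such that the pushforward of μ under restriction to the plaquette {1,2}×{1,…,l} equals p. -/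
open MeasureTheory

/-- The transposition of `Fin 2` (swap of the two columns). -/
def flip2 : Fin 2 → Fin 2 := fun i => ⟨1 - i.1, by omega⟩

lemma map_smul_sum {α β ι : Type*} [MeasurableSpace α] [MeasurableSpace β] [Fintype ι]
    (r : ENNReal) (μ : ι → Measure α) {f : α → β} (hf : Measurable f) :
    (r • ∑ i, μ i).map f = r • ∑ i, (μ i).map f := by
  rw [Measure.map_smul, Measure.map_finset_sum' hf.aemeasurable]

section OneDimensional

variable {A : Type*} {m : ℕ}

/-- Local translation invariance of a weight on words of length `m + 1`: the marginals on the
first `m` and on the last `m` letters agree. -/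
def IsLTI [Fintype A] [DecidableEq A] (p : (Fin (m + 1) → A) → ℝ) : Prop :=
  ∀ g : Fin m → A, ∑ c with Fin.init c = g, p c = ∑ c with Fin.tail c = g, p c

/-- A closed walk in the de Bruijn graph of words of length `m + 1`. -/
def IsClosedWalk {n : ℕ} (d : ZMod n → Fin (m + 1) → A) : Prop :=
  ∀ k, Fin.init (d (k + 1)) = Fin.tail (d k)

/-- The number of visits of a closed walk to a word. -/
def visits [DecidableEq A] {n : ℕ} [NeZero n] (d : ZMod n → Fin (m + 1) → A)
    (c : Fin (m + 1) → A) : ℝ :=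
  ∑ k, if d k = c then 1 else 0

/-- Restriction of a bi-infinite sequence to the window `{0, …, m}`. -/
def window (m : ℕ) (x : ℤ → A) (i : Fin (m + 1)) : A := x i.1

lemma IsClosedWalk.apply_eq {n : ℕ} {d : ZMod n → Fin (m + 1) → A} (hd : IsClosedWalk d)
    (i : ℕ) (hi : i < m + 1) (k : ZMod n) : d k ⟨i, hi⟩ = d (k + i) 0 := by
  induction i generalizing k with
  | zero => simp
  | succ i ih =>
    have h := congrFun (hd k) ⟨i, by omega⟩
    simp only [Fin.init, Fin.tail, Fin.castSucc_mk, Fin.succ_mk] at h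
    rw [← h, ih]
    congr 1
    push_cast
    ring

lemma sum_filter_visits [Fintype A] [DecidableEq A] {n : ℕ} [NeZero n]
    (d : ZMod n → Fin (m + 1) → A) (P : (Fin (m + 1) → A) → Prop) [DecidablePred P] :
    ∑ c with P c, visits d c = ∑ k, if P (d k) then 1 else 0 := by
  simp only [visits]
  rw [Finset.sum_comm]
  refine Finset.sum_congr rfl fun k _ => ?_
  rw [Finset.sum_ite_eq]
  simp

lemma IsClosedWalk.isLTI_visits [Fintype A] [DecidableEq A] {n : ℕ} [NeZero n]
    {d : ZMod n → Fin (m + 1) → A} (hd : IsClosedWalk d) : IsLTI (visits d) := by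
  intro g
  rw [sum_filter_visits, sum_filter_visits, ← Equiv.sum_comp (Equiv.addRight (1 : ZMod n))]
  simp only [Equiv.coe_addRight, hd _]

lemma IsLTI.exists_closedWalk [Fintype A] [DecidableEq A] {p : (Fin (m + 1) → A) → ℝ}
    (hp : IsLTI p) (hpos : ∀ c, 0 ≤ p c) {c₀ : Fin (m + 1) → A} (hc₀ : 0 < p c₀) :
    ∃ (n : ℕ) (_ : NeZero n) (d : ZMod n → Fin (m + 1) → A),
      IsClosedWalk d ∧ ∀ k, 0 < p (d k) := by
  have step : ∀ c : {c // 0 < p c}, ∃ c' : {c // 0 < p c},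
      Fin.init c'.1 = Fin.tail c.1 := by
    rintro ⟨c, hc⟩
    have h : 0 < ∑ c' with Fin.init c' = Fin.tail c, p c' := by
      rw [hp]
      exact hc.trans_le (Finset.single_le_sum (fun c _ => hpos c) (by simp))
    obtain ⟨c', hc', hpc'⟩ := Finset.exists_lt_of_sum_lt (f := fun _ => (0 : ℝ)) (by simpa using h)
    exact ⟨⟨c', hpc'⟩, (Finset.mem_filter.1 hc').2⟩
  choose f hf using step
  obtain ⟨i, j, hij, heq⟩ :=
    Set.Finite.exists_lt_map_eq_of_forall_mem (t := Set.univ)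
      (f := fun i : ℕ => f^[i] ⟨c₀, hc₀⟩) (fun _ => Set.mem_univ _) Set.finite_univ
  obtain ⟨n, rfl⟩ := Nat.exists_eq_add_of_lt hij
  set c := f^[i] ⟨c₀, hc₀⟩
  have hper : Function.IsPeriodicPt f (n + 1) c := by
    rw [Function.IsPeriodicPt, Function.IsFixedPt, ← Function.iterate_add_apply]
    rw [show n + 1 + i = i + n + 1 by ring]
    exact heq.symm
  refine ⟨n + 1, inferInstance, fun k => (f^[k.val] c).1, fun k => ?_, fun k => (f^[k.val] c).2⟩
  have hval : f^[(k + 1).val] c = f (f^[k.val] c) := by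
    rw [ZMod.val_add, ZMod.val_one_eq_one_mod, Nat.add_mod_mod, hper.iterate_mod_apply,
      Function.iterate_succ_apply']
  simp only [hval, hf]

variable [MeasurableSpace A]

lemma measurable_window : Measurable (window m : (ℤ → A) → _) :=
  measurable_pi_lambda _ fun _ => measurable_pi_apply _

/-- The sum of the point masses at all translates of the periodic sequence of a closed walk. -/
noncomputable def orbitMeasure {n : ℕ} [NeZero n] (d : ZMod n → Fin (m + 1) → A) :
    Measure (ℤ → A) :=
  ∑ k : ZMod n, Measure.dirac fun j : ℤ => d (k + j) 0

lemma measurable_shift (v : ℤ) : Measurable fun (x : ℤ → A) w => x (w + v) :=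
  measurable_pi_lambda _ fun _ => measurable_pi_apply _

lemma orbitMeasure_map_shift {n : ℕ} [NeZero n] (d : ZMod n → Fin (m + 1) → A) (v : ℤ) :
    (orbitMeasure d).map (fun x w => x (w + v)) = orbitMeasure d := by
  rw [orbitMeasure, Measure.map_finset_sum' (measurable_shift v).aemeasurable,
    ← Equiv.sum_comp (Equiv.addRight (v : ZMod n)) fun k => Measure.dirac fun j : ℤ => d (k + j) 0]
  refine Finset.sum_congr rfl fun k _ => ?_
  rw [Measure.map_dirac' (measurable_shift v)]
  congr 1
  ext j
  simp only [Equiv.coe_addRight, Int.cast_add]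
  congr 1
  ring

lemma IsClosedWalk.orbitMeasure_map_window [Fintype A] [DecidableEq A] [DiscreteMeasurableSpace A]
    {n : ℕ} [NeZero n] {d : ZMod n → Fin (m + 1) → A} (hd : IsClosedWalk d)
    (c : Fin (m + 1) → A) :
    (orbitMeasure d).map (window m) {c} = ENNReal.ofReal (visits d c) := by
  rw [orbitMeasure, Measure.map_finset_sum' measurable_window.aemeasurable,
    Measure.finsetSum_apply, visits, ENNReal.ofReal_sum_of_nonneg fun k _ => by split_ifs <;> simp]
  refine Finset.sum_congr rfl fun k _ => ?_
  have hwin : window m (fun j : ℤ => d (k + j) 0) = d k := by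
    ext i
    simpa [window] using (hd.apply_eq i.1 i.2 k).symm
  rw [Measure.map_dirac' measurable_window,
    hwin, Measure.dirac_apply' _ (measurableSet_singleton c)]
  split_ifs with h <;> simp [h]

/-- Every locally translation invariant weight on words is the window marginal of a translation
invariant measure on bi-infinite sequences. -/
theorem IsLTI.exists_shiftInvariant [Fintype A] [DecidableEq A] [DiscreteMeasurableSpace A]
    {p : (Fin (m + 1) → A) → ℝ} (hp : IsLTI p) (hpos : ∀ c, 0 ≤ p c) :
    ∃ μ : Measure (ℤ → A), (∀ v : ℤ, μ.map (fun x w => x (w + v)) = μ) ∧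
      ∀ c, μ.map (window m) {c} = ENNReal.ofReal (p c) := by
  induction hN : (Finset.univ.filter fun c => 0 < p c).card using Nat.strong_induction_on
    generalizing p with
  | _ N ih =>
  by_cases h0 : ∃ c, 0 < p c
  swap
  · push Not at h0
    refine ⟨0, by simp, fun c => ?_⟩
    simp [ENNReal.ofReal_of_nonpos (h0 c)]
  obtain ⟨c₀, hc₀⟩ := h0
  obtain ⟨n, hn, d, hd, hdp⟩ := hp.exists_closedWalk hpos hc₀
  have hq0 : ∀ c, 0 ≤ visits d c := fun c =>
    Finset.sum_nonneg fun k _ => by split_ifs <;> simp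
  have hqd : ∀ k, 0 < visits d (d k) := fun k =>
    Finset.sum_pos' (fun k _ => by split_ifs <;> simp) ⟨k, Finset.mem_univ _, by simp⟩
  have hqrange : ∀ c, visits d c ≠ 0 → ∃ k, d k = c := by
    intro c hc
    obtain ⟨k, -, hk⟩ := Finset.exists_ne_zero_of_sum_ne_zero hc
    exact ⟨k, by by_contra h; simp [h] at hk⟩
  obtain ⟨k₀, -, hk₀⟩ := Finset.exists_min_image Finset.univ
    (fun k => p (d k) / visits d (d k)) ⟨0, Finset.mem_univ _⟩
  set t := p (d k₀) / visits d (d k₀) with ht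
  have ht0 : 0 ≤ t := div_nonneg (hpos _) (hq0 _)
  have hle : ∀ c, t * visits d c ≤ p c := by
    intro c
    by_cases hc : visits d c = 0
    · simpa [hc] using hpos c
    · obtain ⟨k, rfl⟩ := hqrange c hc
      exact (le_div_iff₀ (hqd k)).1 (hk₀ k (Finset.mem_univ _))
  have hp' : IsLTI fun c => p c - t * visits d c := by
    intro g
    simp only [Finset.sum_sub_distrib, ← Finset.mul_sum]
    rw [hp g, hd.isLTI_visits g]
  have hcard : (Finset.univ.filter fun c => 0 < p c - t * visits d c).card < N := by
    rw [← hN]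
    refine Finset.card_lt_card (Finset.ssubset_iff_of_subset ?_ |>.2 ⟨d k₀, ?_, ?_⟩)
    · intro c hc
      simp only [Finset.mem_filter, Finset.mem_univ, true_and] at hc ⊢
      have := mul_nonneg ht0 (hq0 c)
      linarith
    · simpa using hdp k₀
    · simp [ht, div_mul_cancel₀ _ (hqd k₀).ne']
  obtain ⟨μ, hμ, hμw⟩ := ih _ hcard hp' (fun c => sub_nonneg.2 (hle c)) rfl
  refine ⟨μ + ENNReal.ofReal t • orbitMeasure d, fun v => ?_, fun c => ?_⟩
  · rw [Measure.map_add _ _ (measurable_shift v), Measure.map_smul, hμ, orbitMeasure_map_shift]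
  · rw [Measure.map_add _ _ measurable_window, Measure.map_smul, Measure.add_apply,
      Measure.smul_apply, hμw, hd.orbitMeasure_map_window, smul_eq_mul, ← ENNReal.ofReal_mul ht0,
      ← ENNReal.ofReal_add (sub_nonneg.2 (hle c)) (mul_nonneg ht0 (hq0 c)), sub_add_cancel]

end OneDimensional

section Alternate

variable {S : Type*}

/-- Repeat a bi-infinite sequence of pairs periodically along the first axis, with phase `s`. -/
def alternate (s : ZMod 2) (y : ℤ → ZMod 2 → S) (w : ℤ × ℤ) : S :=
  y (w.2 - 1) ((w.1 : ZMod 2) - 1 + s)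

lemma alternate_add (s : ZMod 2) (y : ℤ → ZMod 2 → S) (w v : ℤ × ℤ) :
    alternate s y (w + v) = alternate (s + v.1) (fun j => y (j + v.2)) w := by
  simp only [alternate, Prod.fst_add, Prod.snd_add, Int.cast_add]
  congr 1
  · ring_nf
  · ring

lemma alternate_neg (s : ZMod 2) (y : ℤ → ZMod 2 → S) (w : ℤ × ℤ) :
    alternate s y (-w.1, w.2) = alternate s y w := by
  simp [alternate]

lemma measurable_alternate [MeasurableSpace S] (s : ZMod 2) :
    Measurable (alternate s : (ℤ → ZMod 2 → S) → _) :=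
  measurable_pi_lambda _ fun _ => (measurable_pi_apply _).comp (measurable_pi_apply _)

end Alternate

/-- Any distribution `p` on the configurations of a 2×l plaquette that is invariant under
swapping the two columns and locally translation invariant along the second axis is the
plaquette marginal of a probability measure on `S^(ℤ×ℤ)` invariant under all translations
and under the reflection of the first axis. -/
theorem stmt10 {S : Type*} [Fintype S] [Nonempty S] [DecidableEq S]
    [MeasurableSpace S] [DiscreteMeasurableSpace S]
    {l : ℕ} (hl : 2 ≤ l)
    (p : (Fin 2 × Fin l → S) → ℝ)
    (hpos : ∀ c, 0 ≤ p c) (hsum : ∑ c, p c = 1)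
    (hcol : ∀ c, p (fun q => c (flip2 q.1, q.2)) = p c)
    (hLTI : ∀ g : Fin 2 × Fin (l - 1) → S,
      (∑ c ∈ Finset.univ.filter (fun c : Fin 2 × Fin l → S =>
          ∀ q : Fin 2 × Fin (l - 1),
            c (q.1, ⟨q.2.1, by have := q.2.2; omega⟩) = g q), p c) =
      (∑ c ∈ Finset.univ.filter (fun c : Fin 2 × Fin l → S =>
          ∀ q : Fin 2 × Fin (l - 1),
            c (q.1, ⟨q.2.1 + 1, by have := q.2.2; omega⟩) = g q), p c)) :
    ∃ μ : Measure (ℤ × ℤ → S), IsProbabilityMeasure μ ∧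
      (∀ v : ℤ × ℤ, μ.map (fun x w => x (w + v)) = μ) ∧
      (μ.map (fun x w => x (-w.1, w.2)) = μ) ∧
      ∀ c : Fin 2 × Fin l → S,
        μ.map (fun x (q : Fin 2 × Fin l) => x ((q.1.1 : ℤ) + 1, (q.2.1 : ℤ) + 1)) {c}
          = ENNReal.ofReal (p c) := by
  obtain ⟨m, rfl⟩ : ∃ m, l = m + 1 := ⟨l - 1, by omega⟩
  let e : (Fin (m + 1) → ZMod 2 → S) ≃ (Fin 2 × Fin (m + 1) → S) :=
    { toFun := fun c q => c q.2 q.1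
      invFun := fun c i a => c (a, i)
      left_inv := fun _ => rfl
      right_inv := fun _ => rfl }
  have hLTI' : IsLTI fun c => p (e c) := by
    intro g
    have h := hLTI fun q => g q.2 q.1
    simp only [Finset.sum_filter] at h ⊢
    rw [← e.sum_comp, ← e.sum_comp] at h
    convert h using 3 with c _ c _
    · constructor
      · rintro rfl q; rfl
      · intro h; ext i a; exact h (a, i)
    · constructor
      · rintro rfl q; rfl
      · intro h; ext i a; exact h (a, i)
  obtain ⟨ν, hν, hνw⟩ := hLTI'.exists_shiftInvariant fun c => hpos _
  have hshift : ∀ s : ZMod 2, ∀ c : Fin 2 × Fin (m + 1) → S,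
      p (e fun i a => c ((a - s : ZMod 2), i)) = p c := by
    intro s c
    have hs : s = 0 ∨ s = 1 := by decide +revert
    obtain rfl | rfl := hs
    · simp only [sub_zero]
      rfl
    · rw [← hcol c]
      congr 1
      ext ⟨a, i⟩
      have ha : ((show ZMod 2 from a) - 1 : ZMod 2) = flip2 a := by fin_cases a <;> rfl
      exact congrArg (fun b => c (b, i)) ha
  let R : (ℤ × ℤ → S) → Fin 2 × Fin (m + 1) → S := fun x q => x ((q.1.1 : ℤ) + 1, (q.2.1 : ℤ) + 1)
  have hR : Measurable R := measurable_pi_lambda _ fun _ => measurable_pi_apply _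
  have hcast : ∀ a : Fin 2, ((a.1 : ℕ) : ZMod 2) = (a : ZMod 2) := by
    intro a
    fin_cases a <;> rfl
  have hmarg : ∀ s c, (ν.map (alternate s)).map R {c} = ENNReal.ofReal (p c) := by
    intro s c
    rw [Measure.map_map hR (measurable_alternate s),
      Measure.map_apply (hR.comp (measurable_alternate s)) (measurableSet_singleton c),
      ← hshift s c, ← hνw, Measure.map_apply measurable_window (measurableSet_singleton _)]
    congr 1
    ext y
    simp only [Set.mem_preimage, Set.mem_singleton_iff, Function.comp_apply, R, alternate]
    constructor
    · rintro rfl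
      ext i a
      simp only [Int.cast_add, Int.cast_natCast, Int.cast_one, add_sub_cancel_right]
      rw [hcast (a - s : ZMod 2), sub_add_cancel]
      rfl
    · intro h
      ext ⟨a, i⟩
      simp only [Int.cast_add, Int.cast_natCast, Int.cast_one, add_sub_cancel_right]
      rw [hcast a]
      refine (congrFun (congrFun h i) ((show ZMod 2 from a) + s)).trans ?_
      exact congrArg (fun b => c (b, i)) (add_sub_cancel_right (show ZMod 2 from a) s)
  let μ : Measure (ℤ × ℤ → S) := (2⁻¹ : ENNReal) • ∑ s : ZMod 2, ν.map (alternate s)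
  have hμ : ∀ c, μ.map R {c} = ENNReal.ofReal (p c) := by
    intro c
    rw [map_smul_sum _ _ hR, Measure.smul_apply, Measure.finsetSum_apply,
      Finset.sum_congr rfl fun s _ => hmarg s c,
      Finset.sum_const, Finset.card_univ, ZMod.card, nsmul_eq_mul, smul_eq_mul, ← mul_assoc,
      Nat.cast_ofNat, ENNReal.inv_mul_cancel two_ne_zero ENNReal.ofNat_ne_top, one_mul]
  refine ⟨μ, ⟨?_⟩, fun v => ?_, ?_, hμ⟩
  · have h : μ.map R Set.univ = 1 := by
      rw [← Finset.coe_univ, ← sum_measure_singleton, Finset.sum_congr rfl fun c _ => hμ c,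
        ← ENNReal.ofReal_sum_of_nonneg fun c _ => hpos c, hsum, ENNReal.ofReal_one]
    rwa [Measure.map_apply hR MeasurableSet.univ, Set.preimage_univ] at h
  · have hv : Measurable fun (x : ℤ × ℤ → S) w => x (w + v) :=
      measurable_pi_lambda _ fun _ => measurable_pi_apply _
    rw [map_smul_sum _ _ hv]
    simp only [μ]
    rw [← Equiv.sum_comp (Equiv.addRight (v.1 : ZMod 2)) fun s => ν.map (alternate s)]
    congr 1
    refine Finset.sum_congr rfl fun s _ => ?_
    rw [Measure.map_map hv (measurable_alternate s)]
    conv_rhs => rw [← hν v.2, Measure.map_map (measurable_alternate _) (measurable_shift _)]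
    congr 1
    ext y w
    exact alternate_add s y w v
  · have hneg : Measurable fun (x : ℤ × ℤ → S) (w : ℤ × ℤ) => x (-w.1, w.2) :=
      measurable_pi_lambda _ fun _ => measurable_pi_apply _
    rw [map_smul_sum _ _ hneg]
    congr 1
    refine Finset.sum_congr rfl fun s _ => ?_
    rw [Measure.map_map hneg (measurable_alternate s)]
    congr 1
    ext y w
    exact alternate_neg s y w
end
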